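/- arXiv:2207.04232 — 3 statements merged into one kernel-verified Lean document; each statement's English description precedes it below -/
import Mathlib

section
/- Let q be an odd prime power, write q − 1 = e_1·e_2 with e_1 odd, let θ be a primitive element (generator) of F_q^* and H_1 = ⟨θ^{e_1}⟩. Let t be an odd positive integer and let α_1, …, α_t be distinct elements of H_1 such that η(−L_a(α_k)) = 1 for every 1 ≤ k ≤ t, where L_a(α_k) = ∏_{j ≠ k} (α_k − α_j). If moreover η(e_1) = 1, then there exists an MDS self-dual code over F_q of length t·e_1 + 1. -/
open Finset

/-- The Euclidean dual of a linear code `C ⊆ F^n`. -/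
def euclideanDual {F : Type*} [Field F] {n : ℕ} (C : Submodule F (Fin n → F)) :
    Submodule F (Fin n → F) where
  carrier := {x | ∀ c ∈ C, ∑ i, x i * c i = 0}
  add_mem' := by
    intro a b ha hb c hc
    have h : ∑ i, (a + b) i * c i = (∑ i, a i * c i) + ∑ i, b i * c i := by
      rw [← Finset.sum_add_distrib]
      exact Finset.sum_congr rfl fun i _ => by simp [add_mul]
    simp only [Set.mem_setOf_eq] at *
    rw [h, ha c hc, hb c hc, add_zero]
  zero_mem' := by
    intro c hc
    simp
  smul_mem' := by
    intro r a ha c hc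
    have h : ∑ i, (r • a) i * c i = r * ∑ i, a i * c i := by
      rw [Finset.mul_sum]
      exact Finset.sum_congr rfl fun i _ => by simp [mul_assoc]
    simp only [Set.mem_setOf_eq] at *
    rw [h, ha c hc, mul_zero]

/-- Hamming weight of a word. -/
noncomputable def hWeight {F : Type*} [Field F] {n : ℕ} (c : Fin n → F) : ℕ := Nat.card {i : Fin n // c i ≠ 0}

/-- `C` is an MDS (Euclidean) self-dual code: it equals its Euclidean dual and its
minimum Hamming distance is `n/2 + 1`. -/
def IsMDSSelfDual {F : Type*} [Field F] {n : ℕ} (C : Submodule F (Fin n → F)) : Prop :=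
  C = euclideanDual C ∧
  (∀ c ∈ C, c ≠ 0 → n / 2 + 1 ≤ hWeight c) ∧
  (∃ c ∈ C, c ≠ 0 ∧ hWeight c = n / 2 + 1)

open Classical in
/-- The quadratic character `η` of a field: `1` on nonzero squares, `-1` on nonsquares,
`0` at `0`. -/
noncomputable def quadChar (F : Type*) [Field F] (x : F) : ℤ :=
  if x = 0 then 0 else if IsSquare x then 1 else -1

open Polynomial

/-- The evaluation map of the extended generalized Reed-Solomon code of dimension `r + 1` with
evaluation points `a` and column multipliers `v`. -/
noncomputable def extendedGRSMap {F : Type*} [Field F] {m : ℕ} (r : ℕ) (a v : Fin m → F) :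
    F[X] →ₗ[F] (Fin (m + 1) → F) where
  toFun f := Fin.snoc (α := fun _ => F) (fun i => v i * f.eval (a i)) (f.coeff r)
  map_add' f g := by
    ext i
    refine Fin.lastCases ?_ (fun i => ?_) i <;> simp [mul_add]
  map_smul' c f := by
    ext i
    refine Fin.lastCases ?_ (fun i => ?_) i <;> simp [mul_left_comm]

section ExtendedGRS

variable {F : Type*} [Field F] {m : ℕ} (r : ℕ) (a v : Fin m → F)

@[simp] lemma extendedGRSMap_castSucc (f : F[X]) (i : Fin m) :
    extendedGRSMap r a v f i.castSucc = v i * f.eval (a i) := by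
  simp [extendedGRSMap]

@[simp] lemma extendedGRSMap_last (f : F[X]) :
    extendedGRSMap r a v f (Fin.last m) = f.coeff r := by
  simp [extendedGRSMap]

/-- The extended generalized Reed-Solomon code of dimension `r + 1`. -/
noncomputable def extendedGRS : Submodule F (Fin (m + 1) → F) :=
  (degreeLT F (r + 1)).map (extendedGRSMap r a v)

open Classical in
lemma hWeight_eq_card_add (c : Fin (m + 1) → F) :
    hWeight c = #{i : Fin m | c i.castSucc ≠ 0} + if c (Fin.last m) ≠ 0 then 1 else 0 := by
  rw [hWeight, Nat.card_eq_fintype_card, Fintype.card_subtype, card_filter,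
    Fin.sum_univ_castSucc, card_filter]

variable {r a v}

open Classical in
lemma hWeight_extendedGRSMap_add (hv : ∀ i, v i ≠ 0) (f : F[X]) :
    hWeight (extendedGRSMap r a v f) + #{i : Fin m | f.eval (a i) = 0} =
      m + if f.coeff r ≠ 0 then 1 else 0 := by
  have h := card_filter_add_card_filter_not (s := (univ : Finset (Fin m)))
    (fun i => f.eval (a i) = 0)
  simp only [card_univ, Fintype.card_fin] at h
  simp only [hWeight_eq_card_add, extendedGRSMap_castSucc, extendedGRSMap_last, ne_eq,
    mul_eq_zero, hv, false_or]
  lia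

open Classical in
lemma card_filter_eval_eq_zero_le (ha : Function.Injective a) {f : F[X]} (hf : f ≠ 0) :
    #{i : Fin m | f.eval (a i) = 0} ≤ f.natDegree := by
  rw [← card_image_of_injective _ ha]
  refine card_le_degree_of_subset_roots fun x hx => ?_
  obtain ⟨i, hi, rfl⟩ := mem_image.1 (mem_def.2 hx)
  simpa [hf] using hi

lemma le_hWeight_extendedGRSMap (ha : Function.Injective a) (hv : ∀ i, v i ≠ 0) {f : F[X]}
    (hf : f ≠ 0) (hdeg : f ∈ degreeLT F (r + 1)) :
    m + 1 ≤ hWeight (extendedGRSMap r a v f) + r := by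
  classical
  have h₁ := hWeight_extendedGRSMap_add (r := r) (a := a) hv f
  have h₂ := card_filter_eval_eq_zero_le ha hf
  have h₃ : f.natDegree < r + 1 := (natDegree_lt_iff_degree_lt hf).2 (mem_degreeLT.1 hdeg)
  split_ifs at h₁ with h
  · lia
  · have : f.natDegree ≠ r := by
      rintro rfl
      exact h (by simpa using hf)
    lia

lemma finrank_extendedGRS (ha : Function.Injective a) (hv : ∀ i, v i ≠ 0) (hr : r ≤ m) :
    Module.finrank F (extendedGRS r a v) = r + 1 := by
  have hinj : Function.Injective ((extendedGRSMap r a v).domRestrict (degreeLT F (r + 1))) := by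
    rw [← LinearMap.ker_eq_bot, LinearMap.ker_eq_bot']
    rintro ⟨f, hf⟩ h
    by_contra hne
    have hw := le_hWeight_extendedGRSMap ha hv (fun h0 => hne (Subtype.ext h0)) hf
    have h0 : extendedGRSMap r a v f = 0 := h
    simp [h0, hWeight] at hw
    lia
  rw [extendedGRS, ← LinearMap.range_domRestrict, LinearMap.finrank_range_of_inj hinj,
    (degreeLTEquiv F (r + 1)).finrank_eq, Module.finrank_fin_fun]

lemma finrank_euclideanDual {n : ℕ} (C : Submodule F (Fin n → F)) :
    Module.finrank F (euclideanDual C) = n - Module.finrank F C := by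
  have h : euclideanDual C = (Matrix.toBilin' (1 : Matrix (Fin n) (Fin n) F)).orthogonal C := by
    ext x
    simp [euclideanDual, LinearMap.BilinForm.mem_orthogonal_iff, Matrix.toBilin'_apply',
      dotProduct, mul_comm]
  rw [h, LinearMap.BilinForm.finrank_orthogonal, Module.finrank_fin_fun]
  exact LinearMap.BilinForm.nondegenerate_toBilin'_of_det_ne_zero' _ (by simp)

lemma eq_euclideanDual_of_le {n : ℕ} {C : Submodule F (Fin n → F)} (h : C ≤ euclideanDual C)
    (hC : n ≤ 2 * Module.finrank F C) : C = euclideanDual C :=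
  Submodule.eq_of_le_of_finrank_le h (by rw [finrank_euclideanDual]; lia)

lemma extendedGRS_le_euclideanDual (ha : Function.Injective a) (hm : m = 2 * r + 1)
    (hva : ∀ i, v i ^ 2 * ∏ j ∈ univ.erase i, (a i - a j) = -1) :
    extendedGRS r a v ≤ euclideanDual (extendedGRS r a v) := by
  rintro _ ⟨f, hf, rfl⟩ _ ⟨g, hg, rfl⟩
  have hf' : f.natDegree ≤ r := natDegree_le_of_degree_le
    (mem_degreeLE.1 (degreeLT_succ_eq_degreeLE (R := F) ▸ hf))
  have hg' : g.natDegree ≤ r := natDegree_le_of_degree_le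
    (mem_degreeLE.1 (degreeLT_succ_eq_degreeLE (R := F) ▸ hg))
  have hdeg : (f * g).degree < #(univ : Finset (Fin m)) := by
    refine degree_le_natDegree.trans_lt ?_
    have := natDegree_mul_le (p := f) (q := g)
    simp only [card_univ, Fintype.card_fin]
    exact_mod_cast (by lia)
  have hsum := Lagrange.coeff_eq_sum (s := univ) (v := a) ha.injOn hdeg
  have hcoeff : (f * g).coeff (r + r) = f.coeff r * g.coeff r :=
    coeff_mul_add_eq_of_natDegree_le hf' hg'
  have hidx : #(univ : Finset (Fin m)) - 1 = r + r := by
    simp only [card_univ, Fintype.card_fin]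
    lia
  rw [hidx, hcoeff] at hsum
  rw [Fin.sum_univ_castSucc]
  simp only [extendedGRSMap_castSucc, extendedGRSMap_last]
  rw [hsum, ← sum_add_distrib]
  refine sum_eq_zero fun i _ => ?_
  have hi := hva i
  have hne : ∏ j ∈ univ.erase i, (a i - a j) ≠ 0 := fun h => by simp [h] at hi
  rw [eval_mul]
  field_simp
  linear_combination f.eval (a i) * g.eval (a i) * hi

theorem isMDSSelfDual_extendedGRS (ha : Function.Injective a) (hm : m = 2 * r + 1)
    (hva : ∀ i, v i ^ 2 * ∏ j ∈ univ.erase i, (a i - a j) = -1) :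
    IsMDSSelfDual (extendedGRS r a v) := by
  classical
  have hv : ∀ i, v i ≠ 0 := fun i h => by simpa [h] using hva i
  refine ⟨eq_euclideanDual_of_le (extendedGRS_le_euclideanDual ha hm hva) ?_, ?_, ?_⟩
  · rw [finrank_extendedGRS ha hv (by lia)]
    lia
  · rintro _ ⟨f, hf, rfl⟩ hne
    have := le_hWeight_extendedGRSMap ha hv (fun h => hne (by simp [h])) hf
    lia
  · obtain ⟨s, -, hs⟩ := exists_subset_card_eq (s := (univ : Finset (Fin m))) (n := r)
      (by simp only [card_univ, Fintype.card_fin]; lia)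
    have hcoeff : (Lagrange.nodal s a).coeff r = 1 := by
      rw [← hs, ← Lagrange.natDegree_nodal (s := s) (v := a)]
      exact Lagrange.nodal_monic.coeff_natDegree
    have hdeg : Lagrange.nodal s a ∈ degreeLT F (r + 1) := by
      rw [mem_degreeLT, Lagrange.degree_nodal, hs]
      exact_mod_cast Nat.lt_succ_self r
    have hzero : #{i : Fin m | (Lagrange.nodal s a).eval (a i) = 0} = r := by
      rw [← hs]
      congr 1
      ext i
      simp [Lagrange.eval_nodal, prod_eq_zero_iff, sub_eq_zero, ha.eq_iff]
    have hw := hWeight_extendedGRSMap_add (r := r) (a := a) hv (Lagrange.nodal s a)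
    rw [hzero, hcoeff, if_pos one_ne_zero] at hw
    refine ⟨_, ⟨_, hdeg, rfl⟩, fun h => ?_, by lia⟩
    have := congrFun h (Fin.last m)
    simp [hcoeff] at this

/-- For a primitive `n`-th root of unity `ζ`, the derivative of `∏ i, (X ^ n - b i ^ n)` at the
root `ζ ^ s * b i`, as a product of differences of roots. -/
lemma prod_erase_sub_of_isPrimitiveRoot {ι : Type*} [Fintype ι] [DecidableEq ι] {n : ℕ}
    {ζ : F} (hn : 0 < n) (hζ : IsPrimitiveRoot ζ n) (b : ι → F) (i : ι) (s : Fin n) :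
    ∏ y ∈ univ.erase (i, s), (ζ ^ (s : ℕ) * b i - ζ ^ (y.2 : ℕ) * b y.1) =
      n * (ζ ^ (s : ℕ) * b i) ^ (n - 1) * ∏ j ∈ univ.erase i, (b i ^ n - b j ^ n) := by
  set x : ι × Fin n → F := fun y => ζ ^ (y.2 : ℕ) * b y.1 with hx
  have hnodal : Lagrange.nodal univ x = ∏ j, (X ^ n - C (b j ^ n)) := by
    rw [Lagrange.nodal_eq, Fintype.prod_prod_type]
    refine prod_congr rfl fun j _ => ?_
    rw [X_pow_sub_C_eq_prod hζ hn rfl, prod_range]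
  have hpow : (x (i, s)) ^ n = b i ^ n := by
    simp only [hx]
    rw [mul_pow, ← pow_mul, mul_comm (s : ℕ), pow_mul, hζ.pow_eq_one, one_pow, one_mul]
  have h := Lagrange.eval_nodal_derivative_eval_node_eq (v := x) (mem_univ (i, s))
  rw [Lagrange.eval_nodal, hnodal, ← mul_prod_erase _ _ (mem_univ i), derivative_mul, eval_add,
    eval_mul, eval_mul] at h
  simp only [eval_sub, eval_pow, eval_X, eval_C, hpow, sub_self, zero_mul, add_zero,
    eval_prod, derivative_sub, derivative_X_pow, derivative_C, sub_zero, eval_mul] at h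
  rw [← h]

end ExtendedGRS

lemma ne_zero_and_isSquare_of_quadChar_eq_one {F : Type*} [Field F] {x : F} (h : quadChar F x = 1) :
    x ≠ 0 ∧ IsSquare x := by
  unfold quadChar at h
  split_ifs at h with h₁ h₂ <;> simp_all

theorem stmt_8 (q e1 e2 t p k : ℕ) (hp : p.Prime) (hpodd : Odd p) (hq : q = p ^ k)
    (hk : 0 < k) (hq1 : q - 1 = e1 * e2) (he1odd : Odd e1)
    (F : Type*) [Field F] [Fintype F] (hF : Fintype.card F = q)
    (θ : Fˣ) (hθ : ∀ x : Fˣ, x ∈ Subgroup.zpowers θ)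
    (ht : Odd t) (ht0 : 0 < t)
    (α : Fin t → Fˣ) (hαinj : Function.Injective α)
    (hαH : ∀ i, α i ∈ Subgroup.zpowers (θ ^ e1))
    (hL : ∀ i : Fin t,
      quadChar F (-(∏ j ∈ Finset.univ.erase i, ((α i : F) - (α j : F)))) = 1)
    (he1sq : quadChar F ((e1 : ℕ) : F) = 1) :
    ∃ C : Submodule F (Fin (t * e1 + 1) → F), IsMDSSelfDual C := by
  have hcard : orderOf θ = e1 * e2 := by
    rw [orderOf_eq_card_of_forall_mem_zpowers hθ, Nat.card_units, Nat.card_eq_fintype_card, hF,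
      hq1]
  have hpos : 0 < e1 * e2 := hcard ▸ orderOf_pos θ
  have he1 : 0 < e1 := Nat.pos_of_mul_pos_right hpos
  have hζ : IsPrimitiveRoot ((θ ^ e2 : Fˣ) : F) e1 :=
    IsPrimitiveRoot.coe_units_iff.2
      ((IsPrimitiveRoot.orderOf θ).pow (hcard ▸ hpos) (hcard.trans (mul_comm _ _)))
  set ζ : F := ((θ ^ e2 : Fˣ) : F)
  have hroot : ∀ i, ∃ y : F, y ^ e1 = α i := fun i => by
    obtain ⟨z, hz⟩ := Subgroup.mem_zpowers_iff.1 (hαH i)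
    refine ⟨((θ ^ z : Fˣ) : F), ?_⟩
    rw [← hz, ← Units.val_pow_eq_pow_val, ← zpow_natCast, ← zpow_natCast, ← zpow_mul, ← zpow_mul,
      mul_comm]
  choose b hb using hroot
  have hb0 : ∀ i, b i ≠ 0 := fun i h => by
    have := hb i
    rw [h, zero_pow he1.ne'] at this
    exact (α i).ne_zero this.symm
  set x : Fin t × Fin e1 → F := fun y => ζ ^ (y.2 : ℕ) * b y.1 with hx
  have hxpow : ∀ y, x y ^ e1 = α y.1 := fun y => by
    simp only [hx]
    rw [mul_pow, ← pow_mul, mul_comm (y.2 : ℕ), pow_mul, hζ.pow_eq_one, one_pow, one_mul, hb]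
  have hxinj : Function.Injective x := by
    rintro ⟨i, s⟩ ⟨j, u⟩ h
    obtain rfl : i = j := hαinj (Units.ext (by rw [← hxpow (i, s), h, hxpow]))
    have hsu : ζ ^ (s : ℕ) = ζ ^ (u : ℕ) := mul_right_cancel₀ (hb0 i) h
    rw [Fin.ext (hζ.pow_inj s.2 u.2 hsu)]
  have hsq : ∀ y, ∃ w : F, w ^ 2 * ∏ z ∈ univ.erase y, (x y - x z) = -1 := by
    rintro ⟨i, s⟩
    obtain ⟨hL0, c, hc⟩ := ne_zero_and_isSquare_of_quadChar_eq_one (hL i)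
    obtain ⟨he0, d, hd⟩ := ne_zero_and_isSquare_of_quadChar_eq_one he1sq
    obtain ⟨l, hl⟩ := he1odd
    have hx0 : x (i, s) ≠ 0 := fun h => by
      have := hxpow (i, s)
      rw [h, zero_pow he1.ne'] at this
      exact (α i).ne_zero this.symm
    have hc0 : c ≠ 0 := by rintro rfl; simp [hc] at hL0
    have hd0 : d ≠ 0 := by rintro rfl; simp [hd] at he0
    have hprod := prod_erase_sub_of_isPrimitiveRoot he1 hζ b i s
    simp only [hb] at hprod
    refine ⟨(c * d * x (i, s) ^ l)⁻¹, ?_⟩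
    rw [hprod, hd, ← neg_neg (∏ j ∈ univ.erase i, ((α i : F) - α j)), hc,
      show e1 - 1 = l * 2 by lia, pow_mul]
    change _ * (d * d * (x (i, s) ^ l) ^ 2 * _) = _
    have : x (i, s) ^ l ≠ 0 := pow_ne_zero _ hx0
    field_simp
  choose w hw using hsq
  obtain ⟨r, hr⟩ := ht.mul he1odd
  refine ⟨extendedGRS r (x ∘ finProdFinEquiv.symm) (w ∘ finProdFinEquiv.symm),
    isMDSSelfDual_extendedGRS (hxinj.comp finProdFinEquiv.symm.injective) hr fun i => ?_⟩
  rw [← hw (finProdFinEquiv.symm i)]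
  congr 1
  exact prod_equiv finProdFinEquiv.symm (fun j => by
    simp only [mem_erase, mem_univ, and_true, ne_eq, EmbeddingLike.apply_eq_iff_eq]) fun j _ => rfl
end

section
/- Let q be an odd prime power with q ≡ 1 (mod 4), and let e_1 be an odd positive divisor of q − 1. Then the image of the integer e_1 in F_q is a nonzero square; equivalently, η(e_1) = 1. -/
open Finset

/-- In a finite field whose cardinality `q` is `1` modulo `4`, every odd divisor of `q - 1` is a
square. -/
theorem isSquare_natCast_of_odd_of_dvd_card_sub_one {F : Type*} [Field F] [Fintype F]
    (hF : Fintype.card F % 4 = 1) {n : ℕ} (hn : Odd n) (hdvd : n ∣ Fintype.card F - 1) :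
    IsSquare (n : F) := by
  have hchar : ringChar F ≠ 2 := fun h => by
    have := FiniteField.even_card_of_char_two h
    omega
  induction n using induction_on_primes with
  | zero => simp at hn
  | one => simp
  | prime_mul ℓ n hℓ ih =>
    obtain ⟨hℓodd, hnodd⟩ := Nat.odd_mul.mp hn
    have : Fact ℓ.Prime := ⟨hℓ⟩
    have hcard : ((Fintype.card F : ℕ) : ZMod ℓ) = 1 := by
      obtain ⟨m, hm⟩ := (dvd_mul_right ℓ n).trans hdvd
      have h : Fintype.card F = ℓ * m + 1 := by omega
      rw [h]
      simp
    have hsq : IsSquare (ℓ : F) := by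
      rw [FiniteField.isSquare_odd_prime_iff hchar (by rintro rfl; exact absurd hℓodd (by decide)),
        ZMod.χ₄_nat_one_mod_four hF, hcard]
      simp
    rw [Nat.cast_mul]
    exact hsq.mul (ih hnodd ((dvd_mul_left n ℓ).trans hdvd))

/-- A divisor of `q - 1` is nonzero in a field with `q` elements. -/
theorem natCast_ne_zero_of_dvd_card_sub_one {F : Type*} [Field F] [Fintype F] {n : ℕ}
    (hdvd : n ∣ Fintype.card F - 1) : (n : F) ≠ 0 := by
  obtain ⟨m, hm⟩ := hdvd
  intro h
  have hcard : Fintype.card F = n * m + 1 := by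
    have := Fintype.card_pos (α := F)
    omega
  simpa [h, hcard] using FiniteField.cast_card_eq_zero F

theorem stmt_9 (q e1 p k : ℕ) (hp : p.Prime) (hpodd : Odd p) (hq : q = p ^ k) (hk : 0 < k)
    (hq4 : q % 4 = 1) (he1odd : Odd e1) (he1pos : 0 < e1) (hdvd : e1 ∣ q - 1)
    (F : Type*) [Field F] [Fintype F] (hF : Fintype.card F = q) :
    (((e1 : ℕ) : F) ≠ 0 ∧ IsSquare ((e1 : ℕ) : F)) ∧ quadChar F ((e1 : ℕ) : F) = 1 := by
  subst hF
  have hne := natCast_ne_zero_of_dvd_card_sub_one hdvd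
  have hsq := isSquare_natCast_of_odd_of_dvd_card_sub_one hq4 he1odd hdvd
  exact ⟨⟨hne, hsq⟩, by simp [quadChar, hne, hsq]⟩
end

section
/- Let q be an odd prime power with q − 1 = e_1·f_1 = e_2·f_2, let θ be a primitive element of F_q^*, and set β = θ^{e_2}. Let t be an even positive integer and let i_1, …, i_t be integers such that the elements α_μ = β^{i_μ f_1} of ⟨θ^{e_2 f_1}⟩ are pairwise distinct. Suppose that the values η(L_a(α_μ)) are equal for all 1 ≤ μ ≤ t, where L_a(α_μ) = ∏_{λ ≠ μ} (α_μ − α_λ). If e_1 is even and e_2(f_1 − 1) is even, then there exists an MDS self-dual code over F_q of length t·f_1. -/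
open Finset

open Polynomial in
/-- The generalized Reed–Solomon code of dimension `m` with nodes `a` and multipliers `v`. -/
noncomputable def grsCode {F : Type*} [Field F] {n : ℕ} (a v : Fin n → F) (m : ℕ) :
    Submodule F (Fin n → F) :=
  (degreeLT F m).map
    (LinearMap.pi fun i => v i • (Polynomial.leval (a i) : F[X] →ₗ[F] F))

section GRS

open Polynomial

variable {F : Type*} [Field F] {n m : ℕ} {a v : Fin n → F}

theorem mem_grsCode {x : Fin n → F} :
    x ∈ grsCode a v m ↔ ∃ p : F[X], p.degree < m ∧ ∀ i, x i = v i * p.eval (a i) := by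
  simp only [grsCode, Submodule.mem_map, mem_degreeLT]
  refine exists_congr fun p => and_congr_right fun _ => ?_
  rw [funext_iff]
  exact forall_congr' fun i => by simp [eq_comm]

theorem sum_sq_mul_eval_eq_mul_coeff (ha : Function.Injective a) {c : F}
    (hc : ∀ i, v i ^ 2 * ∏ j ∈ univ.erase i, (a i - a j) = c) {P : F[X]} (hP : P.degree < n) :
    ∑ i, v i ^ 2 * P.eval (a i) = c * P.coeff (n - 1) := by
  have h := Lagrange.coeff_eq_sum (s := univ) (v := a) ha.injOn (P := P) (by simpa using hP)
  rw [card_univ, Fintype.card_fin] at h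
  rw [h, mul_sum]
  refine sum_congr rfl fun i _ => ?_
  have h0 : ∏ j ∈ univ.erase i, (a i - a j) ≠ 0 :=
    prod_ne_zero_iff.2 fun j hj => sub_ne_zero.2 fun e => (mem_erase.1 hj).1 (ha e).symm
  rw [← hc i]
  field_simp

theorem grsCode_eq_euclideanDual (hn : n = 2 * m) (ha : Function.Injective a) {c : F}
    (hc0 : c ≠ 0) (hv : ∀ i, v i ≠ 0)
    (hc : ∀ i, v i ^ 2 * ∏ j ∈ univ.erase i, (a i - a j) = c) :
    grsCode a v m = euclideanDual (grsCode a v m) := by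
  have key {p r : F[X]} (h : (p * r).degree < n) :
      ∑ i, (v i * p.eval (a i)) * (v i * r.eval (a i)) = c * (p * r).coeff (n - 1) := by
    rw [← sum_sq_mul_eval_eq_mul_coeff ha hc h]
    exact sum_congr rfl fun i _ => by rw [eval_mul]; ring
  ext x
  constructor
  · intro hx y hy
    obtain ⟨p, hp, hxp⟩ := mem_grsCode.1 hx
    obtain ⟨r, hr, hyr⟩ := mem_grsCode.1 hy
    simp only [hxp, hyr]
    by_cases h0 : p * r = 0
    · rw [key (by rw [h0, degree_zero]; exact WithBot.bot_lt_coe _), h0, coeff_zero, mul_zero]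
    · have hp0 := left_ne_zero_of_mul h0
      have hr0 := right_ne_zero_of_mul h0
      have hd := natDegree_mul hp0 hr0
      have hp' := (natDegree_lt_iff_degree_lt hp0).2 hp
      have hr' := (natDegree_lt_iff_degree_lt hr0).2 hr
      rw [key ((natDegree_lt_iff_degree_lt h0).1 (by lia)),
        coeff_eq_zero_of_natDegree_lt (by lia), mul_zero]
  · intro hx
    let h : F[X] := Lagrange.interpolate univ a fun i => x i / v i
    have hh : ∀ i, x i = v i * h.eval (a i) := fun i => by
      rw [Lagrange.eval_interpolate_at_node _ ha.injOn (mem_univ i), mul_div_cancel₀ _ (hv i)]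
    have hdeg : h.degree < n := by
      have := Lagrange.degree_interpolate_lt (s := univ) (fun i => x i / v i) ha.injOn
      rwa [card_univ, Fintype.card_fin] at this
    refine mem_grsCode.2 ⟨h, ?_, hh⟩
    by_contra! hm
    have h0 : h ≠ 0 := by
      rintro h0
      simp [h0] at hm
    have hm' := le_natDegree_of_coe_le_degree hm
    have hn' := (natDegree_lt_iff_degree_lt h0).2 hdeg
    let r : F[X] := X ^ (n - 1 - h.natDegree)
    have hr : r.degree < m := by
      rw [degree_X_pow]
      exact_mod_cast (by lia : n - 1 - h.natDegree < m)
    have hs := hx _ (mem_grsCode.2 ⟨r, hr, fun i => rfl⟩)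
    simp only [hh] at hs
    have hr0 : r ≠ 0 := pow_ne_zero _ X_ne_zero
    have hd : (h * r).natDegree = n - 1 := by
      rw [natDegree_mul h0 hr0, natDegree_X_pow]
      lia
    rw [key ((natDegree_lt_iff_degree_lt (mul_ne_zero h0 hr0)).1 (by lia)), ← hd] at hs
    exact mul_ne_zero hc0 (leadingCoeff_ne_zero.2 (mul_ne_zero h0 hr0)) hs

theorem hWeight_eq_sub [DecidableEq F] (c : Fin n → F) :
    hWeight c = n - #{i | c i = 0} := by
  rw [hWeight, Nat.card_eq_fintype_card, Fintype.card_subtype]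
  have := card_filter_add_card_filter_not (s := (univ : Finset (Fin n))) (fun i => c i = 0)
  rw [card_univ, Fintype.card_fin] at this
  lia

theorem le_hWeight_of_mem_grsCode (hmn : m ≤ n) (ha : Function.Injective a) (hv : ∀ i, v i ≠ 0)
    {x : Fin n → F} (hx : x ∈ grsCode a v m) (hx0 : x ≠ 0) : n - m + 1 ≤ hWeight x := by
  classical
  obtain ⟨p, hp, hxp⟩ := mem_grsCode.1 hx
  have hp0 : p ≠ 0 := by
    rintro rfl
    exact hx0 (funext fun i => by simp [hxp])
  have hlt : #{i | x i = 0} < m := by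
    by_contra! hle
    refine hp0 (eq_zero_of_degree_lt_of_eval_index_eq_zero (v := a) {i | x i = 0} ha.injOn
      (hp.trans_le (Nat.cast_le.2 hle)) fun i hi => ?_)
    have := (mem_filter.1 hi).2
    rw [hxp] at this
    exact (mul_eq_zero.1 this).resolve_left (hv i)
  rw [hWeight_eq_sub]
  lia

theorem exists_mem_grsCode_hWeight_eq (hm : 0 < m) (hmn : m ≤ n) (ha : Function.Injective a)
    (hv : ∀ i, v i ≠ 0) : ∃ x ∈ grsCode a v m, x ≠ 0 ∧ hWeight x = n - m + 1 := by
  classical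
  obtain ⟨s, -, hs⟩ := exists_subset_card_eq (s := (univ : Finset (Fin n))) (n := m - 1)
    (by rw [card_univ, Fintype.card_fin]; lia)
  let x : Fin n → F := fun i => v i * (Lagrange.nodal s a).eval (a i)
  have hx : hWeight x = n - m + 1 := by
    have : ({i | x i = 0} : Finset (Fin n)) = s := by
      ext i
      simp only [x, mem_filter, mem_univ, true_and, mul_eq_zero, hv i, false_or,
        Lagrange.eval_nodal, prod_eq_zero_iff, sub_eq_zero, ha.eq_iff, exists_eq_right']
    rw [hWeight_eq_sub, this, hs]
    lia
  refine ⟨x, mem_grsCode.2 ⟨_, ?_, fun i => rfl⟩, ?_, hx⟩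
  · rw [Lagrange.degree_nodal, hs]
    exact_mod_cast (by lia : m - 1 < m)
  · intro h0
    simp [h0, hWeight] at hx

theorem isMDSSelfDual_grsCode (hm : 0 < m) (hn : n = 2 * m) (ha : Function.Injective a) {c : F}
    (hc0 : c ≠ 0) (hv : ∀ i, v i ≠ 0)
    (hc : ∀ i, v i ^ 2 * ∏ j ∈ univ.erase i, (a i - a j) = c) :
    IsMDSSelfDual (grsCode a v m) := by
  have e : n / 2 + 1 = n - m + 1 := by lia
  refine ⟨grsCode_eq_euclideanDual hn ha hc0 hv hc, ?_, ?_⟩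
  · rw [e]
    exact fun x => le_hWeight_of_mem_grsCode (by lia) ha hv
  · rw [e]
    exact exists_mem_grsCode_hWeight_eq hm (by lia) ha hv

/-- If the derivative of the node polynomial takes values in a single square class, there is an
MDS self-dual code on these nodes. -/
theorem exists_isMDSSelfDual_of_isSquare {ι : Type*} [Fintype ι] [DecidableEq ι] (b : ι → F)
    (hb : Function.Injective b) (e : ι ≃ Fin n) (hn0 : 0 < n) (hn : Even n) {c : F} (hc0 : c ≠ 0)
    (hc : ∀ i, IsSquare (c * ∏ j ∈ univ.erase i, (b i - b j))) :
    ∃ C : Submodule F (Fin n → F), IsMDSSelfDual C := by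
  obtain ⟨m, hm⟩ := hn.two_dvd
  have h0 (i : ι) : ∏ j ∈ univ.erase i, (b i - b j) ≠ 0 :=
    prod_ne_zero_iff.2 fun j hj => sub_ne_zero.2 fun h => (mem_erase.1 hj).1 (hb h).symm
  choose u hu using hc
  have hu0 (i : ι) : u i ≠ 0 := fun h => mul_ne_zero hc0 (h0 i) (by rw [hu, h, mul_zero])
  refine ⟨_, isMDSSelfDual_grsCode (m := m) (a := b ∘ e.symm) (c := c)
    (v := fun k => c / u (e.symm k)) (by lia) hm (hb.comp e.symm.injective) hc0
    (fun k => div_ne_zero hc0 (hu0 _)) fun k => ?_⟩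
  have hprod : ∏ j ∈ univ.erase k, ((b ∘ e.symm) k - (b ∘ e.symm) j) =
      ∏ j ∈ univ.erase (e.symm k), (b (e.symm k) - b j) :=
    prod_equiv e.symm (by simp) (by simp)
  rw [hprod, div_pow, div_mul_eq_mul_div, div_eq_iff (pow_ne_zero _ (hu0 _)), pow_two (u _), ← hu]
  ring

end GRS

theorem quadChar_eq_quadraticChar {F : Type*} [Field F] [Fintype F] [DecidableEq F] (x : F) :
    quadChar F x = quadraticChar F x := by
  rw [quadChar, quadraticChar_apply, quadraticCharFun]
  congr

theorem isSquare_mul_of_quadChar_eq {F : Type*} [Field F] [Fintype F] {x y : F} (hx : x ≠ 0)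
    (hy : y ≠ 0) (h : quadChar F x = quadChar F y) : IsSquare (x * y) := by
  classical
  rw [quadChar_eq_quadraticChar, quadChar_eq_quadraticChar] at h
  rw [← quadraticChar_one_iff_isSquare (mul_ne_zero hx hy), map_mul, h, ← pow_two]
  exact quadraticChar_sq_one hy

open Polynomial in
/-- For the union of the fibres of `x ↦ x ^ f` over distinct `α μ`, the derivative of the node
polynomial `∏ μ, (X ^ f - α μ)`, evaluated at a node. -/
theorem prod_sub_pow_mul_eq {F : Type*} [Field F] {t f : ℕ} (hf : 0 < f) {ω : F}
    (hω : IsPrimitiveRoot ω f) {γ α : Fin t → F} (hγ : ∀ μ, γ μ ^ f = α μ)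
    (i : Fin t × Fin f) :
    ∏ j ∈ univ.erase i, (ω ^ (i.2 : ℕ) * γ i.1 - ω ^ (j.2 : ℕ) * γ j.1) =
      f * (ω ^ (i.2 : ℕ) * γ i.1) ^ (f - 1) * ∏ ν ∈ univ.erase i.1, (α i.1 - α ν) := by
  let b : Fin t × Fin f → F := fun j => ω ^ (j.2 : ℕ) * γ j.1
  have hnodal : Lagrange.nodal univ b = (Lagrange.nodal univ α).comp (X ^ f) := by
    rw [Lagrange.nodal, Lagrange.nodal, Polynomial.prod_comp, Fintype.prod_prod_type]
    refine prod_congr rfl fun μ _ => ?_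
    rw [sub_comp, X_comp, C_comp, X_pow_sub_C_eq_prod hω hf (hγ μ), ← Fin.prod_univ_eq_prod_range
      (fun k => X - C (ω ^ k * γ μ))]
  have hb : b i ^ f = α i.1 := by
    simp only [b]
    rw [mul_pow, hγ, pow_right_comm, hω.pow_eq_one, one_pow, one_mul]
  have h := Lagrange.eval_nodal_derivative_eval_node_eq (v := b) (mem_univ i)
  rw [hnodal, derivative_comp, eval_mul, eval_comp, eval_pow, eval_X, hb,
    Lagrange.eval_nodal_derivative_eval_node_eq (mem_univ i.1), Lagrange.eval_nodal,
    Lagrange.eval_nodal] at h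
  rw [← h, derivative_X_pow, eval_mul, eval_C, eval_pow, eval_X]

theorem injective_mul_of_pow_injective {F : Type*} [Field F] {t f : ℕ} {ω : F}
    (hω : IsPrimitiveRoot ω f) {γ α : Fin t → F} (hγ : ∀ μ, γ μ ^ f = α μ) (hγ0 : ∀ μ, γ μ ≠ 0)
    (hα : Function.Injective α) :
    Function.Injective fun i : Fin t × Fin f => ω ^ (i.2 : ℕ) * γ i.1 := by
  have hpow (i : Fin t × Fin f) : (ω ^ (i.2 : ℕ) * γ i.1) ^ f = α i.1 := by
    rw [mul_pow, hγ, pow_right_comm, hω.pow_eq_one, one_pow, one_mul]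
  rintro ⟨μ, i⟩ ⟨ν, j⟩ h
  have hμ : μ = ν := hα (by rw [← hpow (μ, i), ← hpow (ν, j)]; exact congrArg (· ^ f) h)
  subst hμ
  exact Prod.ext rfl (Fin.ext (hω.pow_inj i.2 j.2 (mul_right_cancel₀ (hγ0 μ) h)))

theorem stmt_13 (q e1 f1 e2 f2 t p k : ℕ) (hp : p.Prime) (hpodd : Odd p) (hq : q = p ^ k)
    (hk : 0 < k) (h1 : q - 1 = e1 * f1) (h2 : q - 1 = e2 * f2)
    (F : Type*) [Field F] [Fintype F] (hF : Fintype.card F = q)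
    (θ : Fˣ) (hθ : ∀ x : Fˣ, x ∈ Subgroup.zpowers θ)
    (ht : Even t) (ht0 : 0 < t)
    (idx : Fin t → ℤ)
    (α : Fin t → Fˣ) (hα : ∀ μ, α μ = (θ ^ e2) ^ (idx μ * (f1 : ℤ)))
    (hαinj : Function.Injective α)
    (hL : ∀ μ ν : Fin t,
      quadChar F (∏ lam ∈ Finset.univ.erase μ, ((α μ : F) - (α lam : F))) =
      quadChar F (∏ lam ∈ Finset.univ.erase ν, ((α ν : F) - (α lam : F))))
    (he1 : Even e1) (he2f1 : Even (e2 * (f1 - 1))) :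
    ∃ C : Submodule F (Fin (t * f1) → F), IsMDSSelfDual C := by
  classical
  have hq1 : 1 < q := hF ▸ Fintype.one_lt_card
  have hf0 : 0 < f1 := Nat.pos_of_ne_zero fun h => by simp [h] at h1; lia
  have he0 : e1 ≠ 0 := fun h => by simp [h] at h1; lia
  have hθo : orderOf θ = e1 * f1 := by
    rw [orderOf_eq_card_of_forall_mem_zpowers hθ, Nat.card_eq_fintype_card,
      Fintype.card_units, hF, h1]
  have hω : IsPrimitiveRoot ((θ ^ e1 : Fˣ) : F) f1 := by
    rw [IsPrimitiveRoot.coe_units_iff]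
    have := IsPrimitiveRoot.orderOf (θ ^ e1)
    rwa [orderOf_pow_of_dvd he0 (hθo ▸ dvd_mul_right _ _), hθo,
      Nat.mul_div_cancel_left _ (Nat.pos_of_ne_zero he0)] at this
  let γ : Fin t → F := fun μ => (((θ ^ e2) ^ idx μ : Fˣ) : F)
  have hγ (μ : Fin t) : γ μ ^ f1 = α μ := by
    simp only [γ]
    rw [hα, zpow_mul, zpow_natCast, Units.val_pow_eq_pow_val]
  have hf1F : (f1 : F) ≠ 0 := by
    have : NeZero f1 := ⟨hf0.ne'⟩
    exact (hω.neZero').ne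
  have hαF : Function.Injective fun μ => (α μ : F) := Units.val_injective.comp hαinj
  have hL0 (μ : Fin t) : ∏ lam ∈ univ.erase μ, ((α μ : F) - (α lam : F)) ≠ 0 :=
    prod_ne_zero_iff.2 fun j hj => sub_ne_zero.2 fun h => (mem_erase.1 hj).1 (hαF h).symm
  let μ₀ : Fin t := ⟨0, ht0⟩
  refine exists_isMDSSelfDual_of_isSquare _
    (injective_mul_of_pow_injective hω hγ (fun μ => Units.ne_zero _) hαF) finProdFinEquiv
    (Nat.mul_pos ht0 hf0) (ht.mul_right _) (mul_ne_zero hf1F (hL0 μ₀)) fun i => ?_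
  rw [prod_sub_pow_mul_eq hf0 hω hγ]
  have hsq1 : IsSquare (((θ ^ e1 : Fˣ) : F) ^ (i.2 : ℕ)) := by
    rw [Units.val_pow_eq_pow_val]
    exact (he1.isSquare_pow _).pow _
  have hsq2 : IsSquare (γ i.1 ^ (f1 - 1)) := by
    have : γ i.1 ^ (f1 - 1) = ((((θ ^ (e2 * (f1 - 1))) ^ idx i.1 : Fˣ)) : F) := by
      simp only [γ]
      rw [← Units.val_pow_eq_pow_val, ← zpow_natCast, ← zpow_mul, mul_comm, zpow_mul, zpow_natCast,
        ← pow_mul]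
    rw [this]
    exact ((he2f1.isSquare_pow θ).zpow _).map (Units.coeHom F)
  have hsq3 := isSquare_mul_of_quadChar_eq (hL0 μ₀) (hL0 i.1) (hL μ₀ i.1)
  have := ((IsSquare.mul_self (f1 : F)).mul ((hsq1.pow (f1 - 1)).mul hsq2)).mul hsq3
  rw [mul_pow]
  refine Eq.subst (motive := IsSquare) ?_ this
  ring
end
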